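/- arXiv:1706.00729 — 3 statements merged into one kernel-verified Lean document; each statement's English description precedes it below -/
import Mathlib

section
/- For a Markov chain choice model: λ_j = π(j, N) for every j ∈ N₊, and for every i ∈ N and j ∈ N₊ with i ≠ j, ρ_{i,j} · π(i, N) = π(j, N \ {i}) − π(j, N). -/
open Matrix Filter Finset

/-- The product-by-product submatrix `ρ̃` of the transition matrix
(rows/columns indexed by the products `1,…,n`, i.e. the nonzero states). -/
def subRho {n : ℕ} (rho : Matrix (Fin (n+1)) (Fin (n+1)) ℝ) : Matrix (Fin n) (Fin n) ℝ :=
  Matrix.of fun i j => rho i.succ j.succ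

/-- Markov chain choice model: `lam` is a probability vector on the states `{0,1,…,n}`,
`rho` is row-stochastic, state `0` (no purchase) is absorbing, there are no self-loops on
product states, and the product-by-product submatrix `ρ̃` is irreducible. -/
def IsMCCM {n : ℕ} (lam : Fin (n+1) → ℝ) (rho : Matrix (Fin (n+1)) (Fin (n+1)) ℝ) : Prop :=
  (∀ i, 0 ≤ lam i) ∧ (∑ i, lam i = 1) ∧
  (∀ i j, 0 ≤ rho i j) ∧ (∀ i, ∑ j, rho i j = 1) ∧
  rho 0 0 = 1 ∧
  (∀ i : Fin (n+1), i ≠ 0 → rho i i = 0) ∧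
  (∀ i j : Fin n, ∃ t : ℕ, 1 ≤ t ∧ 0 < (subRho rho ^ t) i j)

/-- `ρ^S`: the transition matrix with every row `i ∈ S` replaced by the `i`-th standard
basis vector, so that all states of `S ∪ {0}` are absorbing. -/
def absorb {n : ℕ} (rho : Matrix (Fin (n+1)) (Fin (n+1)) ℝ) (S : Finset (Fin (n+1))) :
    Matrix (Fin (n+1)) (Fin (n+1)) ℝ :=
  Matrix.of fun i j => if i ∈ S then (if j = i then (1 : ℝ) else 0) else rho i j

/-- The conditional choice probability `π(j, S ∣ i) := lim_{t→∞} ((ρ^S)^t)_{i,j}`. -/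
noncomputable def condProb {n : ℕ} (rho : Matrix (Fin (n+1)) (Fin (n+1)) ℝ)
    (S : Finset (Fin (n+1))) (i j : Fin (n+1)) : ℝ :=
  limUnder atTop fun t : ℕ => (absorb rho S ^ t) i j

/-- The choice probability `π(j, S) := ∑_{k ∈ N₊} λ_k · π(j, S ∣ k)`. -/
noncomputable def choiceProb {n : ℕ} (lam : Fin (n+1) → ℝ)
    (rho : Matrix (Fin (n+1)) (Fin (n+1)) ℝ) (S : Finset (Fin (n+1))) (j : Fin (n+1)) : ℝ :=
  ∑ k, lam k * condProb rho S k j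

/-- If `ρ^S` is idempotent, its powers stabilise and the choice probabilities are its entries. -/
lemma condProb_of_isIdempotentElem {n : ℕ} {rho : Matrix (Fin (n+1)) (Fin (n+1)) ℝ}
    {S : Finset (Fin (n+1))} (hS : IsIdempotentElem (absorb rho S)) (i j : Fin (n+1)) :
    condProb rho S i j = absorb rho S i j := by
  refine Tendsto.limUnder_eq (tendsto_const_nhds.congr' ?_)
  filter_upwards [eventually_ge_atTop 1] with t ht
  rw [hS.pow_eq (by omega)]

/-- The no-purchase row of the transition matrix is a standard basis vector. -/
lemma IsMCCM.rho_zero {n : ℕ} {lam : Fin (n+1) → ℝ} {rho : Matrix (Fin (n+1)) (Fin (n+1)) ℝ}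
    (h : IsMCCM lam rho) (j : Fin (n+1)) : rho 0 j = if j = 0 then 1 else 0 := by
  obtain ⟨-, -, hnonneg, hsum, h00, -, -⟩ := h
  split_ifs with hj
  · rw [hj, h00]
  · have hs := hsum 0
    rw [← Finset.add_sum_erase _ _ (Finset.mem_univ 0), h00, add_eq_left,
      Finset.sum_eq_zero_iff_of_nonneg fun k _ => hnonneg 0 k] at hs
    exact hs j (by simp [hj])

/-- Offering every product makes all states absorbing. -/
lemma IsMCCM.absorb_univ_erase_zero {n : ℕ} {lam : Fin (n+1) → ℝ}
    {rho : Matrix (Fin (n+1)) (Fin (n+1)) ℝ} (h : IsMCCM lam rho) :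
    absorb rho (Finset.univ.erase 0) = 1 := by
  ext k j
  rcases eq_or_ne k 0 with rfl | hk
  · simp [absorb, h.rho_zero, Matrix.one_apply, eq_comm]
  · simp [absorb, hk, Matrix.one_apply, eq_comm]

/-- Withdrawing a single product leaves its row as the only non-trivial one. -/
lemma IsMCCM.absorb_erase {n : ℕ} {lam : Fin (n+1) → ℝ}
    {rho : Matrix (Fin (n+1)) (Fin (n+1)) ℝ} (h : IsMCCM lam rho) {i : Fin (n+1)} (hi : i ≠ 0)
    (k j : Fin (n+1)) :
    absorb rho ((Finset.univ.erase 0).erase i) k j =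
      if k = i then rho i j else if k = j then 1 else 0 := by
  rcases eq_or_ne k i with rfl | hki
  · simp [absorb]
  · rcases eq_or_ne k 0 with rfl | hk
    · simp [absorb, h.rho_zero, hki, eq_comm]
    · simp [absorb, hk, hki, eq_comm (a := j)]

lemma IsMCCM.isIdempotentElem_absorb_erase {n : ℕ} {lam : Fin (n+1) → ℝ}
    {rho : Matrix (Fin (n+1)) (Fin (n+1)) ℝ} (h : IsMCCM lam rho) {i : Fin (n+1)} (hi : i ≠ 0) :
    IsIdempotentElem (absorb rho ((Finset.univ.erase 0).erase i)) := by
  have hii : rho i i = 0 := h.2.2.2.2.2.1 i hi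
  ext k j
  simp only [Matrix.mul_apply, h.absorb_erase hi]
  rcases eq_or_ne k i with rfl | hki
  · simp only [if_true]
    have hterm : ∀ m, rho k m * (if m = k then rho k j else if m = j then 1 else 0) =
        if m = j then rho k m else 0 := by
      intro m
      rcases eq_or_ne m k with rfl | hm
      · simp [hii]
      · simp [hm]
    simp [hterm]
  · simp only [if_neg hki, ite_mul, one_mul, zero_mul, Finset.sum_ite_eq, Finset.mem_univ,
      if_true]

/-- For a Markov chain choice model, `λ_j = π(j, N)` for every `j ∈ N₊`,
and `ρ_{i,j} · π(i, N) = π(j, N \ {i}) − π(j, N)` for every `i ∈ N` and `j ∈ N₊` with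
`i ≠ j`.  Here `N = {1,…,n}` is the full-products assortment. -/
theorem mccm_params_from_large_assortments {n : ℕ} (hn : 2 ≤ n)
    (lam : Fin (n+1) → ℝ) (rho : Matrix (Fin (n+1)) (Fin (n+1)) ℝ)
    (h : IsMCCM lam rho) :
    (∀ j : Fin (n+1), lam j = choiceProb lam rho (Finset.univ.erase 0) j) ∧
    (∀ i j : Fin (n+1), i ≠ 0 → i ≠ j →
      rho i j * choiceProb lam rho (Finset.univ.erase 0) i =
        choiceProb lam rho ((Finset.univ.erase 0).erase i) j -
          choiceProb lam rho (Finset.univ.erase 0) j) := by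
  have hN (j : Fin (n+1)) : choiceProb lam rho (Finset.univ.erase 0) j = lam j := by
    have hidem : IsIdempotentElem (absorb rho (Finset.univ.erase 0)) := by
      rw [h.absorb_univ_erase_zero]
      exact IsIdempotentElem.one
    simp [choiceProb, condProb_of_isIdempotentElem hidem, h.absorb_univ_erase_zero,
      Matrix.one_apply]
  refine ⟨fun j => (hN j).symm, fun i j hi hij => ?_⟩
  have hterm (k : Fin (n+1)) :
      lam k * (if k = i then rho i j else if k = j then 1 else 0) =
        (if k = i then lam k * rho i j else 0) + if k = j then lam k else 0 := by
    rcases eq_or_ne k i with rfl | hk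
    · simp [hij]
    · simp [hk]
  rw [hN, hN]
  simp only [choiceProb, condProb_of_isIdempotentElem (h.isIdempotentElem_absorb_erase hi),
    h.absorb_erase hi, hterm, Finset.sum_add_distrib, Finset.sum_ite_eq',
    Finset.mem_univ, if_true]
  ring
end

section
/- Consider a Markov chain choice model without the 'no purchase' option. Let 𝒮 be a family of nonempty subsets of N, let S′ ⊆ N be nonempty, and let 𝒮′ := 𝒮 ∪ {S′}. Define V_𝒮 := Span{ h_{j,S} : S ∈ 𝒮, j ∈ S }, V_{S′} := Span{ h_{j,S′} : j ∈ S′ }, and V_{𝒮′} := V_𝒮 + V_{S′}. Then dim(V_{𝒮′}) ≥ dim(V_𝒮) + |S′| − max{ 1, |(⋃_{S∈𝒮} S) ∩ S′| }. -/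
open Matrix Filter Finset

/-- The vector `h_{j,S} = (π(j, S ∣ k))_{k ∈ N} ∈ ℝ^n` (no "no purchase" option). -/
noncomputable def hvecN {n : ℕ} (rho : Matrix (Fin (n+1)) (Fin (n+1)) ℝ)
    (S : Finset (Fin (n+1))) (j : Fin (n+1)) : Fin n → ℝ :=
  fun k => condProb rho S k.succ j

/-- The functions on the products that are harmonic for `ρ̃` at every product outside `T`. -/
def harmonicOff {n : ℕ} (rho : Matrix (Fin (n+1)) (Fin (n+1)) ℝ) (T : Finset (Fin (n+1))) :
    Submodule ℝ (Fin n → ℝ) where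
  carrier := {f | ∀ i : Fin n, i.succ ∉ T → (subRho rho *ᵥ f) i = f i}
  zero_mem' := by simp
  add_mem' := by
    intro f g hf hg i hi
    simp [Matrix.mulVec_add, hf i hi, hg i hi]
  smul_mem' := by
    intro c f hf i hi
    simp [Matrix.mulVec_smul, hf i hi]

theorem harmonicOff_mono {n : ℕ} (rho : Matrix (Fin (n+1)) (Fin (n+1)) ℝ)
    {T T' : Finset (Fin (n+1))} (hT : T ⊆ T') : harmonicOff rho T ≤ harmonicOff rho T' :=
  fun _ hf i hi => hf i fun h => hi (hT h)

theorem harmonicOff_inf_le {n : ℕ} (rho : Matrix (Fin (n+1)) (Fin (n+1)) ℝ)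
    (T T' : Finset (Fin (n+1))) :
    harmonicOff rho T ⊓ harmonicOff rho T' ≤ harmonicOff rho (T ∩ T') := by
  rintro f ⟨hf, hf'⟩ i hi
  by_cases h : i.succ ∈ T
  · exact hf' i fun h' => hi (Finset.mem_inter.2 ⟨h, h'⟩)
  · exact hf i h

/-- Maximum principle: for an irreducible stochastic matrix, a function that is harmonic outside
a nonempty set on which it is nonpositive is nonpositive everywhere. -/
theorem nonpos_of_harmonic_off {ι : Type*} [Fintype ι] [DecidableEq ι] {P : Matrix ι ι ℝ}
    (hP : ∀ i j, 0 ≤ P i j) (hsum : ∀ i, ∑ j, P i j = 1)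
    (hirr : ∀ i j, ∃ t : ℕ, 1 ≤ t ∧ 0 < (P ^ t) i j) {T : Set ι} (hT : T.Nonempty)
    {f : ι → ℝ} (hf : ∀ i ∉ T, (P *ᵥ f) i = f i) (hfT : ∀ i ∈ T, f i ≤ 0) (i : ι) :
    f i ≤ 0 := by
  obtain ⟨a, ha⟩ := hT
  have : Nonempty ι := ⟨a⟩
  obtain ⟨m, hm⟩ := Finite.exists_max f
  by_contra! hi
  have hmpos : 0 < f m := hi.trans_le (hm i)
  have step : ∀ k j, f k = f m → 0 < P k j → f j = f m := by
    intro k j hk hkj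
    have hkT : k ∉ T := fun h => by linarith [hfT k h]
    have hsum0 : ∑ l, P k l * (f m - f l) = 0 := by
      have h1 := hf k hkT
      simp only [Matrix.mulVec, dotProduct] at h1
      simp only [mul_sub, Finset.sum_sub_distrib, ← Finset.sum_mul, hsum, h1, hk]
      ring
    have hzero := (Finset.sum_eq_zero_iff_of_nonneg fun l _ =>
      mul_nonneg (hP k l) (sub_nonneg.2 (hm l))).1 hsum0 j (Finset.mem_univ j)
    rcases mul_eq_zero.1 hzero with h | h <;> linarith
  have hpow : ∀ t : ℕ, ∀ j, 0 < (P ^ t) m j → f j = f m := by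
    intro t
    induction t with
    | zero =>
      intro j hj
      by_cases h : m = j
      · rw [h]
      · simp [h] at hj
    | succ t ih =>
      intro j hj
      rw [pow_succ, Matrix.mul_apply] at hj
      obtain ⟨l, -, hl⟩ := Finset.exists_lt_of_sum_lt
        (s := Finset.univ) (f := fun _ : ι => (0 : ℝ)) (by simpa using hj)
      have hPlj : 0 < P l j := by
        refine (hP l j).lt_of_ne fun h => ?_
        rw [← h, mul_zero] at hl
        exact lt_irrefl _ hl
      exact step l j (ih l (pos_of_mul_pos_left hl hPlj.le)) hPlj
  obtain ⟨t, -, ht⟩ := hirr m a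
  linarith [hpow t a ht, hfT a ha]

theorem eq_zero_of_mem_harmonicOff {n : ℕ} {rho : Matrix (Fin (n+1)) (Fin (n+1)) ℝ}
    (hP : ∀ i j, 0 ≤ subRho rho i j) (hsum : ∀ i, ∑ j, subRho rho i j = 1)
    (hirr : ∀ i j, ∃ t : ℕ, 1 ≤ t ∧ 0 < (subRho rho ^ t) i j)
    {T : Finset (Fin (n+1))} {a : Fin n} (ha : a.succ ∈ T) {f : Fin n → ℝ}
    (hf : f ∈ harmonicOff rho T) (hfT : ∀ i : Fin n, i.succ ∈ T → f i = 0) : f = 0 := by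
  have hT : {i : Fin n | i.succ ∈ T}.Nonempty := ⟨a, ha⟩
  funext i
  apply le_antisymm
  · exact nonpos_of_harmonic_off hP hsum hirr hT hf (fun i hi => (hfT i hi).le) i
  · have := nonpos_of_harmonic_off hP hsum hirr hT (neg_mem hf)
      (fun i hi => by simp [hfT i hi]) i
    simpa using this

theorem finrank_harmonicOff_le {n : ℕ} {rho : Matrix (Fin (n+1)) (Fin (n+1)) ℝ}
    (hP : ∀ i j, 0 ≤ subRho rho i j) (hsum : ∀ i, ∑ j, subRho rho i j = 1)
    (hirr : ∀ i j, ∃ t : ℕ, 1 ≤ t ∧ 0 < (subRho rho ^ t) i j)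
    {T : Finset (Fin (n+1))} {a : Fin n} (ha : a.succ ∈ T) :
    Module.finrank ℝ (harmonicOff rho T) ≤ T.card := by
  let φ : (Fin n → ℝ) →ₗ[ℝ] (T → ℝ) :=
    LinearMap.pi fun t => Fin.cases 0 (fun i => LinearMap.proj i) t.1
  have hφ : Function.Injective (φ ∘ₗ (harmonicOff rho T).subtype) := by
    rw [← LinearMap.ker_eq_bot, LinearMap.ker_eq_bot']
    rintro ⟨f, hf⟩ hf0
    refine Subtype.ext (eq_zero_of_mem_harmonicOff hP hsum hirr ha hf fun i hi => ?_)
    simpa [φ] using congrFun hf0 ⟨i.succ, hi⟩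
  simpa using LinearMap.finrank_le_finrank_of_injective hφ

theorem finrank_harmonicOff_le_max {n : ℕ} {rho : Matrix (Fin (n+1)) (Fin (n+1)) ℝ}
    (hn : 0 < n) (hP : ∀ i j, 0 ≤ subRho rho i j) (hsum : ∀ i, ∑ j, subRho rho i j = 1)
    (hirr : ∀ i j, ∃ t : ℕ, 1 ≤ t ∧ 0 < (subRho rho ^ t) i j)
    {T : Finset (Fin (n+1))} (hT : (0 : Fin (n+1)) ∉ T) :
    Module.finrank ℝ (harmonicOff rho T) ≤ max 1 T.card := by
  rcases T.eq_empty_or_nonempty with rfl | ⟨x, hx⟩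
  · refine (Submodule.finrank_mono (harmonicOff_mono rho
      (Finset.empty_subset {Fin.succ (⟨0, hn⟩ : Fin n)}))).trans ?_
    simpa using finrank_harmonicOff_le hP hsum hirr
      (Finset.mem_singleton_self (Fin.succ (⟨0, hn⟩ : Fin n)))
  · obtain ⟨a, rfl⟩ := Fin.exists_succ_eq.2 (fun h => hT (h ▸ hx))
    exact (finrank_harmonicOff_le hP hsum hirr hx).trans (le_max_right _ _)

theorem absorb_pow_apply_of_mem {n : ℕ} (rho : Matrix (Fin (n+1)) (Fin (n+1)) ℝ)
    {S : Finset (Fin (n+1))} {i : Fin (n+1)} (hi : i ∈ S) (j : Fin (n+1)) (t : ℕ) :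
    (absorb rho S ^ t) i j = if j = i then 1 else 0 := by
  induction t with
  | zero => simp [Matrix.one_apply, eq_comm]
  | succ t ih => simp [pow_succ', Matrix.mul_apply, absorb, hi, ← ih]

theorem condProb_of_mem {n : ℕ} (rho : Matrix (Fin (n+1)) (Fin (n+1)) ℝ)
    {S : Finset (Fin (n+1))} {i : Fin (n+1)} (hi : i ∈ S) (j : Fin (n+1)) :
    condProb rho S i j = if j = i then 1 else 0 := by
  simp only [condProb, absorb_pow_apply_of_mem rho hi]
  exact tendsto_const_nhds.limUnder_eq

theorem absorb_mem_rowStochastic {n : ℕ} {rho : Matrix (Fin (n+1)) (Fin (n+1)) ℝ}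
    (hrho : ∀ i j, 0 ≤ rho i j) (hsum : ∀ i, ∑ j, rho i j = 1) (S : Finset (Fin (n+1))) :
    absorb rho S ∈ rowStochastic ℝ (Fin (n+1)) := by
  rw [mem_rowStochastic_iff_sum]
  constructor <;> intro i
  · intro j
    simp only [absorb, Matrix.of_apply]
    split_ifs <;> simp [hrho]
  · by_cases hi : i ∈ S <;> simp [absorb, hi, hsum]

/-- The limit defining `π(j, S ∣ i)` exists when `j` is absorbing. -/
theorem tendsto_condProb {n : ℕ} {rho : Matrix (Fin (n+1)) (Fin (n+1)) ℝ}
    (hrho : ∀ i j, 0 ≤ rho i j) (hsum : ∀ i, ∑ j, rho i j = 1) {S : Finset (Fin (n+1))}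
    {j : Fin (n+1)} (hj : j ∈ S) (i : Fin (n+1)) :
    Tendsto (fun t : ℕ => (absorb rho S ^ t) i j) atTop (nhds (condProb rho S i j)) := by
  have hst := absorb_mem_rowStochastic hrho hsum S
  have hpow : ∀ t : ℕ, absorb rho S ^ t ∈ rowStochastic ℝ (Fin (n+1)) := fun t => pow_mem hst t
  have hmono : Monotone fun t : ℕ => (absorb rho S ^ t) i j := by
    refine monotone_nat_of_le_succ fun t => ?_
    rw [pow_succ, Matrix.mul_apply]
    have hjj : absorb rho S j j = 1 := by simp [absorb, hj]
    calc (absorb rho S ^ t) i j = (absorb rho S ^ t) i j * absorb rho S j j := by simp [hjj]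
      _ ≤ _ := Finset.single_le_sum
        (f := fun l => (absorb rho S ^ t) i l * absorb rho S l j)
        (fun l _ => mul_nonneg (nonneg_of_mem_rowStochastic (hpow t))
          (nonneg_of_mem_rowStochastic hst)) (Finset.mem_univ j)
  have hbdd : BddAbove (Set.range fun t : ℕ => (absorb rho S ^ t) i j) :=
    ⟨1, by rintro _ ⟨t, rfl⟩; exact le_one_of_mem_rowStochastic (hpow t)⟩
  exact tendsto_nhds_limUnder ⟨_, tendsto_atTop_ciSup hmono hbdd⟩

theorem condProb_of_notMem {n : ℕ} {rho : Matrix (Fin (n+1)) (Fin (n+1)) ℝ}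
    (hrho : ∀ i j, 0 ≤ rho i j) (hsum : ∀ i, ∑ j, rho i j = 1) {S : Finset (Fin (n+1))}
    {j : Fin (n+1)} (hj : j ∈ S) {i : Fin (n+1)} (hi : i ∉ S) :
    condProb rho S i j = ∑ l, rho i l * condProb rho S l j := by
  refine tendsto_nhds_unique
    ((tendsto_condProb hrho hsum hj i).comp (tendsto_add_atTop_nat 1)) ?_
  have hstep : ((fun t : ℕ => (absorb rho S ^ t) i j) ∘ fun t => t + 1) =
      fun t : ℕ => ∑ l, rho i l * (absorb rho S ^ t) l j := by
    funext t
    simp [pow_succ', Matrix.mul_apply, absorb, hi]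
  rw [hstep]
  exact tendsto_finsetSum _ fun l _ => (tendsto_condProb hrho hsum hj l).const_mul _

theorem hvecN_mem_harmonicOff {n : ℕ} {rho : Matrix (Fin (n+1)) (Fin (n+1)) ℝ}
    (hrho : ∀ i j, 0 ≤ rho i j) (hsum : ∀ i, ∑ j, rho i j = 1)
    (hrho0 : ∀ i : Fin (n+1), i ≠ 0 → rho i 0 = 0) {S : Finset (Fin (n+1))}
    {j : Fin (n+1)} (hj : j ∈ S) : hvecN rho S j ∈ harmonicOff rho S := by
  intro i hi
  simp only [hvecN]
  rw [condProb_of_notMem hrho hsum hj hi, Fin.sum_univ_succ, hrho0 _ (Fin.succ_ne_zero i)]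
  simp [Matrix.mulVec, dotProduct, subRho, hvecN]

theorem linearIndependent_hvecN {n : ℕ} (rho : Matrix (Fin (n+1)) (Fin (n+1)) ℝ)
    {S : Finset (Fin (n+1))} (hS : (0 : Fin (n+1)) ∉ S) :
    LinearIndependent ℝ fun j : S => hvecN rho S j := by
  rw [Fintype.linearIndependent_iff]
  rintro g hg ⟨i, hi⟩
  obtain ⟨k, rfl⟩ := Fin.exists_succ_eq.2 (fun h => hS (h ▸ hi))
  have h := congrFun hg k
  simp only [Finset.sum_apply, Pi.smul_apply, smul_eq_mul, hvecN, condProb_of_mem rho hi,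
    Pi.zero_apply] at h
  rw [Finset.sum_eq_single ⟨k.succ, hi⟩ (fun b _ hb => by
    rw [if_neg fun h' => hb (Subtype.ext h'), mul_zero]) (by simp)] at h
  simpa using h

theorem finrank_span_hvecN {n : ℕ} (rho : Matrix (Fin (n+1)) (Fin (n+1)) ℝ)
    {S : Finset (Fin (n+1))} (hS : (0 : Fin (n+1)) ∉ S) :
    Module.finrank ℝ (Submodule.span ℝ {x : Fin n → ℝ | ∃ j ∈ S, x = hvecN rho S j}) =
      S.card := by
  have hrange : {x : Fin n → ℝ | ∃ j ∈ S, x = hvecN rho S j} =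
      Set.range fun j : S => hvecN rho S j := by
    ext x
    simp [eq_comm]
  rw [hrange, finrank_span_eq_card (linearIndependent_hvecN rho hS), Fintype.card_coe]

/-- (No "no purchase" option.)  For a family `𝒮` of nonempty assortments
and a further nonempty assortment `S'`, with `V_𝒮 = Span{h_{j,S} : S ∈ 𝒮, j ∈ S}` and
`V_{S'} = Span{h_{j,S'} : j ∈ S'}`, one has
`dim(V_𝒮 + V_{S'}) ≥ dim V_𝒮 + |S'| − max{1, |(⋃_{S∈𝒮} S) ∩ S'|}`. -/
theorem mccm_dim_multiple_assortments {n : ℕ} (hn : 2 ≤ n)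
    (lam : Fin (n+1) → ℝ) (rho : Matrix (Fin (n+1)) (Fin (n+1)) ℝ)
    (h : IsMCCM lam rho)
    (hlam0 : lam 0 = 0) (hrho0 : ∀ i : Fin (n+1), i ≠ 0 → rho i 0 = 0)
    (𝓢 : Finset (Finset (Fin (n+1))))
    (h𝓢 : ∀ S ∈ 𝓢, (0 : Fin (n+1)) ∉ S ∧ S.Nonempty)
    (S' : Finset (Fin (n+1))) (hS'0 : (0 : Fin (n+1)) ∉ S') (hS'ne : S'.Nonempty) :
    (Module.finrank ℝ
        ↥(Submodule.span ℝ {x : Fin n → ℝ | ∃ S ∈ 𝓢, ∃ j ∈ S, x = hvecN rho S j} ⊔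
          Submodule.span ℝ {x : Fin n → ℝ | ∃ j ∈ S', x = hvecN rho S' j}) : ℤ) ≥
      (Module.finrank ℝ
        ↥(Submodule.span ℝ {x : Fin n → ℝ | ∃ S ∈ 𝓢, ∃ j ∈ S, x = hvecN rho S j}) : ℤ) +
        (S'.card : ℤ) - (max 1 ((𝓢.sup id ∩ S').card) : ℤ) := by
  obtain ⟨-, -, hrho, hsum, -, -, hirr⟩ := h
  have hP : ∀ i j, 0 ≤ subRho rho i j := fun i j => hrho _ _
  have hPsum : ∀ i, ∑ j, subRho rho i j = 1 := by
    intro i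
    have := hsum i.succ
    rwa [Fin.sum_univ_succ, hrho0 _ (Fin.succ_ne_zero i), zero_add] at this
  set V := Submodule.span ℝ {x : Fin n → ℝ | ∃ S ∈ 𝓢, ∃ j ∈ S, x = hvecN rho S j} with hV
  set V' := Submodule.span ℝ {x : Fin n → ℝ | ∃ j ∈ S', x = hvecN rho S' j} with hV'
  have hVle : V ≤ harmonicOff rho (𝓢.sup id) := by
    rw [hV, Submodule.span_le]
    rintro _ ⟨S, hS, j, hj, rfl⟩
    exact harmonicOff_mono rho (Finset.le_sup (f := id) hS)
      (hvecN_mem_harmonicOff hrho hsum hrho0 hj)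
  have hVle' : V' ≤ harmonicOff rho S' := by
    rw [hV', Submodule.span_le]
    rintro _ ⟨j, hj, rfl⟩
    exact hvecN_mem_harmonicOff hrho hsum hrho0 hj
  have hinf : Module.finrank ℝ ↥(V ⊓ V') ≤ max 1 (𝓢.sup id ∩ S').card :=
    (Submodule.finrank_mono ((inf_le_inf hVle hVle').trans (harmonicOff_inf_le rho _ _))).trans
      (finrank_harmonicOff_le_max (by omega) hP hPsum hirr
        fun h0 => hS'0 (Finset.mem_inter.1 h0).2)
  have hdim := Submodule.finrank_sup_add_finrank_inf_eq V V'
  have hcard : Module.finrank ℝ V' = S'.card := finrank_span_hvecN rho hS'0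
  omega
end

section
/- For a Markov chain choice model and any nonempty assortment S ⊆ N, the vectors h_{j,S} := (π(j, S | k))_{k∈N₊} ∈ ℝ^{n+1} for j ∈ S₊ are linearly independent, so dim(Span{ h_{j,S} : j ∈ S₊ }) = |S| + 1; moreover Span{ h_{j,S} : j ∈ S₊ } is orthogonal to Span{ a_i : i ∈ N \ S }, where a_i := e_i − ρ_i is the i-th row of I − ρ (with rows indexed by N₊). -/
open Matrix Filter Finset

/-- The vector `h_{j,S} = (π(j, S ∣ k))_{k ∈ N₊} ∈ ℝ^{n+1}`. -/
noncomputable def hvec {n : ℕ} (rho : Matrix (Fin (n+1)) (Fin (n+1)) ℝ)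
    (S : Finset (Fin (n+1))) (j : Fin (n+1)) : Fin (n+1) → ℝ :=
  fun k => condProb rho S k j

section RowStochastic

variable {ι : Type*} [Fintype ι] [DecidableEq ι] {P : Matrix ι ι ℝ} {j : ι}

/-- Into an absorbing state `j`, the `t`-step transition probabilities are nondecreasing in `t`. -/
theorem monotone_pow_apply_of_apply_self_eq_one (hP : P ∈ rowStochastic ℝ ι) (hj : P j j = 1)
    (i : ι) : Monotone fun t : ℕ => (P ^ t) i j := by
  refine monotone_nat_of_le_succ fun t => ?_
  rw [pow_succ, Matrix.mul_apply]
  calc (P ^ t) i j = (P ^ t) i j * P j j := by rw [hj, mul_one]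
    _ ≤ ∑ k, (P ^ t) i k * P k j :=
      Finset.single_le_sum (f := fun k => (P ^ t) i k * P k j)
        (fun k _ => mul_nonneg (nonneg_of_mem_rowStochastic (pow_mem hP t))
          (nonneg_of_mem_rowStochastic hP)) (mem_univ j)

theorem tendsto_pow_apply_of_apply_self_eq_one (hP : P ∈ rowStochastic ℝ ι) (hj : P j j = 1)
    (i : ι) : Tendsto (fun t : ℕ => (P ^ t) i j) atTop
      (nhds (limUnder atTop fun t : ℕ => (P ^ t) i j)) := by
  refine tendsto_nhds_limUnder ⟨_, tendsto_atTop_ciSup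
    (monotone_pow_apply_of_apply_self_eq_one hP hj i) ⟨1, ?_⟩⟩
  rintro _ ⟨t, rfl⟩
  exact le_one_of_mem_rowStochastic (pow_mem hP t)

/-- The limiting absorption probabilities into `j` form a harmonic function. -/
theorem limUnder_pow_apply_eq_sum (hP : P ∈ rowStochastic ℝ ι) (hj : P j j = 1) (i : ι) :
    limUnder atTop (fun t : ℕ => (P ^ t) i j) =
      ∑ k, P i k * limUnder atTop (fun t : ℕ => (P ^ t) k j) := by
  have hstep : Tendsto (fun t : ℕ => (P ^ (t + 1)) i j) atTop
      (nhds (∑ k, P i k * limUnder atTop (fun t : ℕ => (P ^ t) k j))) := by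
    simp only [pow_succ', Matrix.mul_apply]
    exact tendsto_finsetSum _ fun k _ =>
      (tendsto_pow_apply_of_apply_self_eq_one hP hj k).const_mul _
  exact tendsto_nhds_unique
    ((tendsto_add_atTop_iff_nat 1).2 (tendsto_pow_apply_of_apply_self_eq_one hP hj i)) hstep

theorem pow_apply_of_row_eq_single {i : ι} (hi : P i = Pi.single i 1) (t : ℕ) (j : ι) :
    (P ^ t) i j = if i = j then 1 else 0 := by
  induction t with
  | zero => rw [pow_zero, Matrix.one_apply]
  | succ t ih => rw [pow_succ', Matrix.mul_apply, hi, ← ih]; simp [Pi.single_apply]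

end RowStochastic

namespace IsMCCM

variable {n : ℕ} {lam : Fin (n+1) → ℝ} {rho : Matrix (Fin (n+1)) (Fin (n+1)) ℝ}
  {S : Finset (Fin (n+1))} {j : Fin (n+1)}

theorem absorb_mem_rowStochastic (h : IsMCCM lam rho) (S : Finset (Fin (n+1))) :
    absorb rho S ∈ rowStochastic ℝ (Fin (n+1)) := by
  rw [mem_rowStochastic_iff_sum]
  refine ⟨fun i j => ?_, fun i => ?_⟩
  · have := h.2.2.1 i j
    simp only [absorb, Matrix.of_apply]
    split_ifs <;> simp [this]
  · have := h.2.2.2.1 i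
    by_cases hi : i ∈ S <;> simp [absorb, hi, this]

theorem row_zero (h : IsMCCM lam rho) : rho 0 = Pi.single 0 1 := by
  obtain ⟨-, -, hnn, hsum, h00, -⟩ := h
  have h0 := hsum 0
  rw [← Finset.add_sum_erase _ _ (mem_univ 0), h00, add_eq_left,
    Finset.sum_eq_zero_iff_of_nonneg fun k _ => hnn 0 k] at h0
  ext k
  by_cases hk : k = 0
  · simp [hk, h00]
  · simp [hk, h0 k (by simp [hk])]

theorem absorb_row (h : IsMCCM lam rho) (hj : j ∈ insert 0 S) :
    absorb rho S j = Pi.single j 1 := by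
  ext k
  by_cases hjS : j ∈ S
  · simp [absorb, hjS, Pi.single_apply]
  · obtain rfl : j = 0 := (mem_insert.1 hj).resolve_right hjS
    simp [absorb, hjS, h.row_zero]

theorem hvec_apply_of_mem (h : IsMCCM lam rho) {k : Fin (n+1)} (hk : k ∈ insert 0 S)
    (j : Fin (n+1)) : hvec rho S j k = if k = j then 1 else 0 := by
  simp only [hvec, condProb, pow_apply_of_row_eq_single (h.absorb_row hk)]
  exact tendsto_const_nhds.limUnder_eq

theorem hvec_eq_sum (h : IsMCCM lam rho) (hj : j ∈ insert 0 S) {i : Fin (n+1)} (hi : i ∉ S) :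
    hvec rho S j i = ∑ k, rho i k * hvec rho S j k := by
  have hjj : absorb rho S j j = 1 := by rw [h.absorb_row hj, Pi.single_eq_same]
  have := limUnder_pow_apply_eq_sum (h.absorb_mem_rowStochastic S) hjj i
  simpa only [hvec, condProb, absorb, Matrix.of_apply, if_neg hi] using this

theorem linearIndependent_hvec (h : IsMCCM lam rho) :
    LinearIndependent ℝ fun j : {x : Fin (n+1) // x ∈ insert 0 S} => hvec rho S j := by
  rw [Fintype.linearIndependent_iff]
  intro g hg k
  have := congrFun hg k
  simpa [Finset.sum_apply, h.hvec_apply_of_mem k.2, Subtype.coe_inj, -Finset.attach_insert] using this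

end IsMCCM

/-- (General case, with the "no purchase" option.)  For any nonempty
assortment `S ⊆ N`, the vectors `h_{j,S} ∈ ℝ^{n+1}` for `j ∈ S₊` are linearly
independent, so `dim Span{h_{j,S} : j ∈ S₊} = |S| + 1`; moreover this span is orthogonal
to `Span{a_i : i ∈ N \ S}` where `a_i = e_i − ρ_i` is the `i`-th row of `I − ρ`. -/
theorem mccm_hvec_linearIndependent_general {n : ℕ} (hn : 2 ≤ n)
    (lam : Fin (n+1) → ℝ) (rho : Matrix (Fin (n+1)) (Fin (n+1)) ℝ)
    (h : IsMCCM lam rho)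
    (S : Finset (Fin (n+1))) (hS0 : (0 : Fin (n+1)) ∉ S) (hSne : S.Nonempty) :
    LinearIndependent ℝ
      (fun j : {x : Fin (n+1) // x ∈ insert (0 : Fin (n+1)) S} =>
        hvec rho S (j : Fin (n+1))) ∧
    Module.finrank ℝ
      ↥(Submodule.span ℝ
        {x : Fin (n+1) → ℝ | ∃ j ∈ insert (0 : Fin (n+1)) S, x = hvec rho S j}) =
      S.card + 1 ∧
    (∀ v ∈ Submodule.span ℝ
        {x : Fin (n+1) → ℝ | ∃ j ∈ insert (0 : Fin (n+1)) S, x = hvec rho S j},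
      ∀ w ∈ Submodule.span ℝ
        {x : Fin (n+1) → ℝ | ∃ i : Fin (n+1), i ≠ 0 ∧ i ∉ S ∧
          x = fun k => (if k = i then (1 : ℝ) else 0) - rho i k},
      ∑ k, v k * w k = 0) := by
  have hli := h.linearIndependent_hvec (S := S)
  refine ⟨hli, ?_, fun v hv w hw => ?_⟩
  · have hset : {x | ∃ j ∈ insert 0 S, x = hvec rho S j} =
        Set.range fun j : {x // x ∈ insert 0 S} => hvec rho S j := by
      ext x
      simp [eq_comm]
    rw [hset, finrank_span_eq_card hli, Fintype.card_coe, card_insert_of_notMem hS0]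
  · change v ⬝ᵥ w = 0
    induction hv, hw using Submodule.span_induction₂ with
    | mem_mem v w hv hw =>
      obtain ⟨j, hj, rfl⟩ := hv
      obtain ⟨i, -, hi, rfl⟩ := hw
      simp [dotProduct, mul_sub, h.hvec_eq_sum hj hi, mul_comm]
    | zero_left => exact zero_dotProduct _
    | zero_right => exact dotProduct_zero _
    | add_left _ _ _ _ _ _ h₁ h₂ => rw [add_dotProduct, h₁, h₂, add_zero]
    | add_right _ _ _ _ _ _ h₁ h₂ => rw [dotProduct_add, h₁, h₂, add_zero]
    | smul_left _ _ _ _ _ h₁ => rw [smul_dotProduct, h₁, smul_zero]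
    | smul_right _ _ _ _ _ h₁ => rw [dotProduct_smul, h₁, smul_zero]
end
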